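/- Let 0 < α < 2, β ∈ ℝ, and μ satisfy απ/2 < μ < min(π, απ). Then there exists a constant C = C(α,β,μ) > 0 such that for every complex z with μ ≤ |arg(z)| ≤ π, the two-parameter Mittag-Leffler function satisfies |E_{α,β}(z)| ≤ C/(1+|z|). -/

import Mathlib

/-- Two-parameter Mittag-Leffler function of a complex variable. -/
noncomputable def mlC (a : ℝ) (b : ℂ) (z : ℂ) : ℂ :=
  ∑' n : ℕ, z ^ n / Complex.Gamma ((a * n : ℝ) + b)

open Complex MeasureTheory Set Filter Topology

/-- Hankel integrand in logarithmic coordinates. -/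
noncomputable def hkF (s : ℝ) (w : ℂ) : ℂ := cexp (cexp w + (1 - s) * w)

/-- Hankel contour integral in logarithmic coordinates. -/
noncomputable def hkJ (f : ℂ → ℂ) (x θ : ℝ) : ℂ :=
  I * (∫ y in (-θ)..θ, f (x + y * I)) + (∫ t in Ioi x, f (t + θ * I))
    - ∫ t in Ioi x, f (t + ((-θ : ℝ) : ℂ) * I)

lemma hkF_norm (s x y : ℝ) :
    ‖hkF s (x + y * I)‖ = Real.exp (Real.exp x * Real.cos y + (1 - s) * x) := by
  rw [hkF, Complex.norm_exp]
  congr 1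
  simp [Complex.exp_re]

lemma hkF_diff (s : ℝ) : Differentiable ℂ (hkF s) := by
  unfold hkF; fun_prop

lemma hkF_cont_h (s θ : ℝ) : Continuous (fun t : ℝ => hkF s (t + θ * I)) :=
  (hkF_diff s).continuous.comp (by fun_prop)

lemma hkF_cont_v (s x : ℝ) : Continuous (fun y : ℝ => hkF s (x + y * I)) :=
  (hkF_diff s).continuous.comp (by fun_prop)

lemma hk_decay (c k : ℝ) (hc : 0 < c) :
    ∃ K > 0, ∀ t : ℝ, 0 ≤ t → Real.exp (-(c * Real.exp t) + k * t) ≤ K * Real.exp (-t) := by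
  refine ⟨Real.exp ((k + 1) ^ 2 / (2 * c)), Real.exp_pos _, fun t ht => ?_⟩
  rw [← Real.exp_add, Real.exp_le_exp]
  have h1 := Real.quadratic_le_exp_of_nonneg ht
  have h2 : c * (t ^ 2 / 2) ≤ c * Real.exp t := by
    apply mul_le_mul_of_nonneg_left _ hc.le
    linarith
  have h3 : (k + 1) * t - c * (t ^ 2 / 2) ≤ (k + 1) ^ 2 / (2 * c) := by
    rw [le_div_iff₀ (by positivity)]
    nlinarith [sq_nonneg (c * t - (k + 1))]
  linarith

lemma hkF_decay (s c : ℝ) (hc : 0 < c) :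
    ∃ K > 0, ∀ t : ℝ, 0 ≤ t → ∀ θ : ℝ, Real.cos θ ≤ -c →
      ‖hkF s (t + θ * I)‖ ≤ K * Real.exp (-t) := by
  obtain ⟨K, hK, h⟩ := hk_decay c (1 - s) hc
  refine ⟨K, hK, fun t ht θ hθ => ?_⟩
  rw [hkF_norm]
  refine le_trans ?_ (h t ht)
  rw [Real.exp_le_exp]
  nlinarith [Real.exp_pos t]

lemma hkF_int (s x θ : ℝ) (hθ : Real.cos θ < 0) :
    IntegrableOn (fun t : ℝ => hkF s (t + θ * I)) (Ioi x) := by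
  obtain ⟨K, hK, h⟩ := hkF_decay s (-Real.cos θ) (by linarith)
  have := integrable_of_isBigO_exp_neg (f := fun t : ℝ => ‖hkF s (t + θ * I)‖) (a := x) (b := 1)
    one_pos (hkF_cont_h s θ).norm.continuousOn (by
      refine Asymptotics.IsBigO.of_bound K ?_
      filter_upwards [eventually_ge_atTop 0] with t ht
      simpa using h t ht θ (by linarith))
  exact (integrable_norm_iff (hkF_cont_h s θ).aestronglyMeasurable).1 this

lemma hkF_tendsto (s θ : ℝ) (hθ : Real.cos θ < 0) :
    Tendsto (fun t : ℝ => hkF s (t + θ * I)) atTop (𝓝 0) := by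
  obtain ⟨K, hK, h⟩ := hkF_decay s (-Real.cos θ) (by linarith)
  have h0 : Tendsto (fun t : ℝ => K * Real.exp (-t)) atTop (𝓝 0) := by
    simpa using (Real.tendsto_exp_neg_atTop_nhds_zero).const_mul K
  refine squeeze_zero_norm' ?_ h0
  filter_upwards [eventually_ge_atTop 0] with t ht
  exact h t ht θ (by linarith)

lemma hk_rect (f : ℂ → ℂ) (x0 x1 y0 y1 : ℝ) (_ : x0 ≤ x1) (hy : y0 ≤ y1)
    (hf : DifferentiableOn ℂ f {w | y0 ≤ w.im ∧ w.im ≤ y1}) :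
    (∫ x in x0..x1, f (x + y0 * I)) - (∫ x in x0..x1, f (x + y1 * I)) +
      I * (∫ y in y0..y1, f (x1 + y * I)) - I * (∫ y in y0..y1, f (x0 + y * I)) = 0 := by
  have := integral_boundary_rect_eq_zero_of_differentiableOn f ⟨x0, y0⟩ ⟨x1, y1⟩ (hf.mono (by
    intro w hw
    have := hw.2
    simp only [mem_preimage, uIcc_of_le hy, mem_Icc] at this
    exact this))
  simpa using this

lemma hk_split (g : ℝ → ℂ) (x0 x1 : ℝ) (hx : x0 ≤ x1) (hg : IntegrableOn g (Ioi x0)) :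
    ∫ t in Ioi x0, g t = (∫ t in x0..x1, g t) + ∫ t in Ioi x1, g t := by
  rw [intervalIntegral.integral_of_le hx, ← setIntegral_union
    (Ioc_disjoint_Ioi le_rfl) measurableSet_Ioi
    (hg.mono_set Ioc_subset_Ioi_self) (hg.mono_set (Ioi_subset_Ioi hx)), Ioc_union_Ioi_eq_Ioi hx]

lemma hkJ_shift (f : ℂ → ℂ) (x0 x1 θ : ℝ) (hx : x0 ≤ x1) (hθ : 0 ≤ θ)
    (hf : DifferentiableOn ℂ f {w | -θ ≤ w.im ∧ w.im ≤ θ})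
    (h1 : IntegrableOn (fun t : ℝ => f (t + θ * I)) (Ioi x0))
    (h2 : IntegrableOn (fun t : ℝ => f (t + ((-θ : ℝ) : ℂ) * I)) (Ioi x0)) :
    hkJ f x0 θ = hkJ f x1 θ := by
  have := hk_rect f x0 x1 (-θ) θ hx (by linarith) hf
  unfold hkJ
  rw [hk_split _ x0 x1 hx h1, hk_split _ x0 x1 hx h2]
  linear_combination (-1 : ℂ) * this

lemma hk_cos_neg {θ : ℝ} (h1 : Real.pi / 2 < θ) (h2 : θ ≤ Real.pi) : Real.cos θ < 0 :=
  Real.cos_neg_of_pi_div_two_lt_of_lt h1 (by linarith [Real.pi_pos])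

/-- Moving a ray between angles with the same negative cosine bound. -/
lemma hk_ray (s x y0 y1 c : ℝ) (hy : y0 ≤ y1) (hc : 0 < c)
    (hcos : ∀ y ∈ Icc y0 y1, Real.cos y ≤ -c) :
    (∫ t in Ioi x, hkF s (t + y0 * I)) - (∫ t in Ioi x, hkF s (t + y1 * I))
      = I * ∫ y in y0..y1, hkF s (x + y * I) := by
  have i0 := hkF_int s x y0 (by linarith [hcos y0 ⟨le_rfl, hy⟩])
  have i1 := hkF_int s x y1 (by linarith [hcos y1 ⟨hy, le_rfl⟩])
  have t0 := intervalIntegral_tendsto_integral_Ioi x i0 tendsto_id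
  have t1 := intervalIntegral_tendsto_integral_Ioi x i1 tendsto_id
  have tv : Tendsto (fun T : ℝ => ∫ y in y0..y1, hkF s (T + y * I)) atTop (𝓝 0) := by
    obtain ⟨K, hK, h⟩ := hkF_decay s c hc
    have h0 : Tendsto (fun t : ℝ => K * Real.exp (-t) * |y1 - y0|) atTop (𝓝 0) := by
      simpa using ((Real.tendsto_exp_neg_atTop_nhds_zero).const_mul K).mul_const (|y1 - y0|)
    refine squeeze_zero_norm' ?_ h0
    filter_upwards [eventually_ge_atTop 0] with t ht
    apply intervalIntegral.norm_integral_le_of_norm_le_const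
    intro y hy'
    rw [uIoc_of_le hy] at hy'
    exact h t ht y (hcos y ⟨hy'.1.le, hy'.2⟩)
  have key : Tendsto (fun T : ℝ => I * (∫ y in y0..y1, hkF s (x + y * I))
      - I * ∫ y in y0..y1, hkF s (T + y * I)) atTop
      (𝓝 ((∫ t in Ioi x, hkF s (t + y0 * I)) - (∫ t in Ioi x, hkF s (t + y1 * I)))) := by
    refine (t0.sub t1).congr' ?_
    filter_upwards [eventually_ge_atTop x] with T hT
    have := hk_rect (hkF s) x T y0 y1 hT hy (hkF_diff s).differentiableOn
    simp only [id]
    linear_combination this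
  have key2 := tendsto_const_nhds (x := I * (∫ y in y0..y1, hkF s (x + y * I))) (f := atTop)
    |>.sub (tv.const_mul I)
  rw [tendsto_nhds_unique key key2]
  simp

lemma hkJ_rot (s x θ : ℝ) (h1 : Real.pi / 2 < θ) (h2 : θ ≤ Real.pi) :
    hkJ (hkF s) x θ = hkJ (hkF s) x Real.pi := by
  have hp := Real.pi_pos
  have hc := hk_cos_neg h1 h2
  have A := hk_ray s x θ Real.pi (-Real.cos θ) h2 (by linarith) (by
    intro y hy
    have := Real.cos_le_cos_of_nonneg_of_le_pi (by linarith) hy.2 hy.1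
    linarith)
  have B := hk_ray s x (-Real.pi) (-θ) (-Real.cos θ) (by linarith) (by linarith) (by
    intro y hy
    have := Real.cos_le_cos_of_nonneg_of_le_pi (x := θ) (y := -y) (by linarith)
      (by linarith [hy.1]) (by linarith [hy.2])
    rw [Real.cos_neg] at this
    linarith)
  have ii : ∀ p q : ℝ, IntervalIntegrable (fun y : ℝ => hkF s (x + y * I)) volume p q :=
    fun p q => (hkF_cont_v s x).intervalIntegrable _ _
  have S1 := intervalIntegral.integral_add_adjacent_intervals (ii (-Real.pi) (-θ)) (ii (-θ) θ)
  have S2 := intervalIntegral.integral_add_adjacent_intervals (ii (-Real.pi) θ) (ii θ Real.pi)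
  unfold hkJ
  rw [← S2, ← S1]
  linear_combination A + B

lemma hkJ_rec (s x : ℝ) :
    hkJ (hkF s) x Real.pi = s * hkJ (hkF (s + 1)) x Real.pi := by
  have hd : ∀ w, HasDerivAt (hkF (s + 1)) (hkF s w - s * hkF (s + 1) w) w := by
    intro w
    have h1 : HasDerivAt (fun w : ℂ => cexp w + (1 - ((s + 1 : ℝ) : ℂ)) * w)
        (cexp w + (1 - ((s + 1 : ℝ) : ℂ)) * 1) w :=
      (Complex.hasDerivAt_exp w).add ((hasDerivAt_id w).const_mul _)
    refine h1.cexp.congr_deriv ?_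
    have : hkF s w = hkF (s + 1) w * cexp w := by
      unfold hkF
      rw [← Complex.exp_add]; congr 1; push_cast; ring
    rw [this]; unfold hkF; push_cast; ring
  have ray : ∀ θ : ℝ, Real.cos θ < 0 → (∫ t in Ioi x, hkF s (t + θ * I))
      = s * (∫ t in Ioi x, hkF (s + 1) (t + θ * I)) - hkF (s + 1) (x + θ * I) := by
    intro θ hθ
    have i0 := hkF_int s x θ hθ
    have i1 := (hkF_int (s + 1) x θ hθ).const_mul (s : ℂ)
    have := integral_Ioi_of_hasDerivAt_of_tendsto
      (f := fun t : ℝ => hkF (s + 1) (t + θ * I))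
      (f' := fun t : ℝ => hkF s (t + θ * I) - s * hkF (s + 1) (t + θ * I)) (a := x)
      (m := 0) (hkF_cont_h _ θ).continuousWithinAt (by
        intro t _
        have h2 : HasDerivAt (fun t : ℝ => (t : ℂ) + θ * I) 1 t := by
          simpa using (Complex.ofRealCLM.hasDerivAt (x := t)).add_const ((θ : ℂ) * I)
        refine ((hd _).comp t h2).congr_deriv ?_
        ring) (i0.sub i1) (hkF_tendsto _ θ hθ)
    rw [integral_sub i0 i1, integral_const_mul] at this
    linear_combination this
  have vert : I * (∫ y in (-Real.pi)..Real.pi, hkF s (x + y * I))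
      = s * (I * (∫ y in (-Real.pi)..Real.pi, hkF (s + 1) (x + y * I)))
        + hkF (s + 1) (x + Real.pi * I) - hkF (s + 1) (x + ((-Real.pi : ℝ) : ℂ) * I) := by
    have c0 : IntervalIntegrable (fun y : ℝ => I * hkF s (x + y * I)) volume (-Real.pi) Real.pi :=
      ((hkF_cont_v s x).const_mul I).intervalIntegrable _ _
    have c1 : IntervalIntegrable (fun y : ℝ => (s * I) * hkF (s + 1) (x + y * I)) volume
      (-Real.pi) Real.pi := ((hkF_cont_v (s + 1) x).const_mul (s * I)).intervalIntegrable _ _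
    have := intervalIntegral.integral_eq_sub_of_hasDerivAt (a := -Real.pi) (b := Real.pi)
      (f := fun y : ℝ => hkF (s + 1) (x + y * I))
      (f' := fun y : ℝ => I * hkF s (x + y * I) - (s * I) * hkF (s + 1) (x + y * I)) (by
        intro y _
        have h2 : HasDerivAt (fun y : ℝ => (x : ℂ) + y * I) I y := by
          simpa using ((Complex.ofRealCLM.hasDerivAt (x := y)).mul_const I).const_add (x : ℂ)
        refine ((hd _).comp y h2).congr_deriv ?_
        ring) (c0.sub c1)
    rw [intervalIntegral.integral_sub c0 c1, intervalIntegral.integral_const_mul,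
      intervalIntegral.integral_const_mul] at this
    linear_combination this
  unfold hkJ
  rw [vert, ray Real.pi (by simp), ray (-Real.pi) (by simp)]
  ring

lemma hk_image : Real.exp '' univ = Ioi 0 := by
  rw [image_univ, Real.range_exp]

lemma hk_gamma_int (p : ℝ) (hp : 0 < p) :
    Integrable (fun t : ℝ => Real.exp (-Real.exp t + p * t)) ∧
      ∫ t : ℝ, Real.exp (-Real.exp t + p * t) = Real.Gamma p := by
  have e : ∀ t : ℝ, |Real.exp t| • (Real.exp (-Real.exp t) * (Real.exp t) ^ (p - 1))
      = Real.exp (-Real.exp t + p * t) := by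
    intro t
    rw [abs_of_pos (Real.exp_pos t), smul_eq_mul, ← Real.exp_mul, ← Real.exp_add, ← Real.exp_add]
    congr 1; ring
  have hd : ∀ x ∈ (univ : Set ℝ), HasDerivWithinAt Real.exp (Real.exp x) univ x :=
    fun x _ => (Real.hasDerivAt_exp x).hasDerivWithinAt
  constructor
  · have := Real.GammaIntegral_convergent hp
    rw [← hk_image, integrableOn_image_iff_integrableOn_abs_deriv_smul MeasurableSet.univ hd
      Real.exp_injective.injOn, integrableOn_univ] at this
    simpa only [e] using this
  · rw [Real.Gamma_eq_integral hp, ← hk_image,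
      integral_image_eq_integral_abs_deriv_smul MeasurableSet.univ hd Real.exp_injective.injOn,
      setIntegral_univ]
    simp only [e]

lemma hkF_pi (s t ε : ℝ) (hε : cexp (ε * I) = -1) :
    hkF s (t + ε * I) =
      (Real.exp (-Real.exp t + (1 - s) * t) : ℝ) * cexp ((1 - s) * (ε * I)) := by
  unfold hkF
  rw [Complex.exp_add (t : ℂ), hε]
  push_cast
  rw [← Complex.exp_add]
  congr 1
  ring

lemma hk_exp_pi : cexp ((Real.pi : ℂ) * I) = -1 := Complex.exp_pi_mul_I

lemma hk_exp_neg_pi : cexp (((-Real.pi : ℝ) : ℂ) * I) = -1 := by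
  push_cast
  rw [neg_mul, Complex.exp_neg, Complex.exp_pi_mul_I]; norm_num

lemma hkJ_lt_one (s : ℝ) (hs : s < 1) :
    hkJ (hkF s) 0 Real.pi = 2 * Real.pi * I / Complex.Gamma s := by
  have hp := Real.pi_pos
  obtain ⟨gi, gv⟩ := hk_gamma_int (1 - s) (by linarith)
  have ray : ∀ ε : ℝ, cexp (ε * I) = -1 →
      Tendsto (fun x : ℝ => ∫ t in Ioi x, hkF s (t + ε * I)) atBot
        (𝓝 (Complex.Gamma (1 - s) * cexp ((1 - s) * (ε * I)))) := by
    intro ε hε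
    have hi : Integrable (fun t : ℝ => hkF s (t + ε * I)) := by
      simp only [hkF_pi s _ ε hε]
      exact gi.ofReal.mul_const _
    have := (aecover_Ioi (μ := volume) (a := fun x : ℝ => x) (l := atBot)
      tendsto_id).integral_tendsto_of_countably_generated hi
    convert this using 2
    simp only [hkF_pi s _ ε hε]
    rw [integral_mul_const, integral_complex_ofReal, gv, ← Complex.Gamma_ofReal]
    push_cast; rfl
  have vert : Tendsto (fun x : ℝ => ∫ y in (-Real.pi)..Real.pi, hkF s (x + y * I)) atBot
      (𝓝 0) := by
    have h0 : Tendsto (fun x : ℝ => Real.exp (1 + (1 - s) * x) * |Real.pi - (-Real.pi)|) atBot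
        (𝓝 0) := by
      have : Tendsto (fun x : ℝ => 1 + (1 - s) * x) atBot atBot :=
        tendsto_atBot_add_const_left _ _ (tendsto_id.const_mul_atBot (by linarith))
      simpa using (Real.tendsto_exp_atBot.comp this).mul_const (|Real.pi - (-Real.pi)|)
    refine squeeze_zero_norm' ?_ h0
    filter_upwards [eventually_le_atBot 0] with x hx
    apply intervalIntegral.norm_integral_le_of_norm_le_const
    intro y _
    rw [hkF_norm, Real.exp_le_exp]
    have h1 : Real.exp x ≤ 1 := Real.exp_le_one_iff.2 hx
    nlinarith [Real.exp_pos x, Real.cos_le_one y]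
  have lim := ((vert.const_mul I).add (ray Real.pi hk_exp_pi)).sub (ray (-Real.pi) hk_exp_neg_pi)
  have hconst : Tendsto (fun x : ℝ => hkJ (hkF s) x Real.pi) atBot
      (𝓝 (hkJ (hkF s) 0 Real.pi)) := by
    refine tendsto_const_nhds.congr' ?_
    filter_upwards [eventually_le_atBot 0] with x hx
    exact (hkJ_shift _ x 0 Real.pi hx hp.le (hkF_diff s).differentiableOn
      (hkF_int s x _ (by simp)) (hkF_int s x _ (by simp))).symm
  have key := tendsto_nhds_unique hconst lim
  rw [key]
  have hrefl := Complex.Gamma_mul_Gamma_one_sub (s : ℂ)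
  have hG : Complex.Gamma (1 - s) ≠ 0 := Complex.Gamma_ne_zero_of_re_pos (by simpa using hs)
  have hsin : cexp ((1 - s) * (Real.pi * I)) - cexp ((1 - s) * (((-Real.pi : ℝ) : ℂ) * I))
      = 2 * I * Complex.sin (Real.pi * s) := by
    have h1 : ((1 : ℂ) - s) * (Real.pi * I) = (Real.pi - Real.pi * s) * I := by ring
    have h2 : ((1 : ℂ) - s) * (((-Real.pi : ℝ) : ℂ) * I) = -(Real.pi - Real.pi * s) * I := by
      push_cast; ring
    rw [h1, h2, ← Complex.sin_pi_sub, Complex.sin]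
    linear_combination (-(cexp (-(Real.pi - Real.pi * s) * I) - cexp ((Real.pi - Real.pi * s) * I)))
      * Complex.I_mul_I
  have hval : I * 0 + Complex.Gamma (1 - s) * cexp ((1 - s) * (Real.pi * I))
      - Complex.Gamma (1 - s) * cexp ((1 - s) * (((-Real.pi : ℝ) : ℂ) * I))
      = 2 * I * (Complex.Gamma (1 - s) * Complex.sin (Real.pi * s)) := by
    linear_combination Complex.Gamma (1 - s) * hsin
  rw [hval]
  by_cases h0 : Complex.sin (Real.pi * s) = 0
  · rw [h0, div_zero] at hrefl
    have : Complex.Gamma s = 0 := by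
      rcases mul_eq_zero.1 hrefl with h | h
      · exact h
      · exact absurd h hG
    rw [h0, this]; simp
  · have hpi : (Real.pi : ℂ) ≠ 0 := by exact_mod_cast hp.ne'
    rw [eq_div_iff h0] at hrefl
    have hG2 : Complex.Gamma s ≠ 0 := by
      intro h; rw [h] at hrefl; simp only [zero_mul] at hrefl; exact hpi hrefl.symm
    rw [eq_div_iff hG2]
    linear_combination 2 * I * hrefl

lemma hkJ_one : hkJ (hkF 1) 0 Real.pi = 2 * Real.pi * I := by
  have hr : ∀ t : ℝ, hkF 1 (t + Real.pi * I) = hkF 1 (t + ((-Real.pi : ℝ) : ℂ) * I) := by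
    intro t
    rw [hkF_pi 1 t _ hk_exp_pi, hkF_pi 1 t _ hk_exp_neg_pi]; simp
  unfold hkJ
  simp only [hr, add_sub_cancel_right]
  have hf : ∀ y : ℝ, hkF 1 ((0 : ℝ) + y * I) = cexp (cexp (y * I)) := by
    intro y; simp [hkF]
  simp only [hf]
  have hper : Function.Periodic (fun y : ℝ => cexp (cexp (y * I))) (2 * Real.pi) := by
    intro y
    have : ((y + 2 * Real.pi : ℝ) : ℂ) * I = y * I + 2 * Real.pi * I := by push_cast; ring
    simp only [this, Complex.exp_periodic (y * I)]
  have h1 := hper.intervalIntegral_add_eq (-Real.pi) 0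
  have e1 : -Real.pi + 2 * Real.pi = Real.pi := by ring
  rw [e1] at h1
  have hc := Complex.circleIntegral_sub_inv_smul_of_differentiable_on_off_countable
    (R := 1) (c := 0) (w := 0) (f := cexp) (s := ∅) countable_empty (by simp)
    Complex.continuous_exp.continuousOn (fun x _ => Complex.differentiable_exp x)
  rw [circleIntegral] at hc
  simp only [zero_add] at h1
  rw [h1, ← intervalIntegral.integral_const_mul]
  have hm : ∀ y : ℝ, circleMap 0 1 y = cexp (y * I) := by intro y; simp [circleMap]
  simp only [deriv_circleMap, hm, sub_zero, smul_eq_mul, Complex.exp_zero, mul_one] at hc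
  rw [← hc]
  congr 1
  ext y
  field_simp [Complex.exp_ne_zero]

lemma hkJ_pi (s : ℝ) : hkJ (hkF s) 0 Real.pi = 2 * Real.pi * I / Complex.Gamma s := by
  obtain ⟨n, hn⟩ := exists_nat_ge s
  induction n generalizing s with
  | zero => exact hkJ_lt_one s (by push_cast at hn; linarith)
  | succ n ih =>
    rcases lt_trichotomy s 1 with h | h | h
    · exact hkJ_lt_one s h
    · subst h; rw [hkJ_one]; simp
    · have h1 := ih (s - 1) (by push_cast at hn; linarith)
      have h2 := hkJ_rec (s - 1) 0
      rw [sub_add_cancel] at h2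
      have hne : ((s - 1 : ℝ) : ℂ) ≠ 0 := by exact_mod_cast (by linarith : s - 1 ≠ 0)
      have h3 := Complex.Gamma_add_one ((s - 1 : ℝ) : ℂ) hne
      have e : ((s - 1 : ℝ) : ℂ) + 1 = s := by push_cast; ring
      rw [e] at h3
      have hG : Complex.Gamma ((s - 1 : ℝ) : ℂ) ≠ 0 :=
        Complex.Gamma_ne_zero_of_re_pos (by simp; linarith)
      rw [h1] at h2
      rw [h3, ← mul_right_inj' hne, ← h2]
      field_simp

lemma hkF_cos_pm {θ : ℝ} (h : Real.cos θ < 0) : Real.cos (-θ) < 0 := by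
  rwa [Real.cos_neg]

lemma hankel (s x θ : ℝ) (hx : 0 ≤ x) (h1 : Real.pi / 2 < θ) (h2 : θ ≤ Real.pi) :
    hkJ (hkF s) x θ = 2 * Real.pi * I / Complex.Gamma s := by
  rw [← hkJ_pi, ← hkJ_rot s 0 θ h1 h2]
  have hc := hk_cos_neg h1 h2
  exact (hkJ_shift _ 0 x θ hx (by linarith [Real.pi_pos]) (hkF_diff s).differentiableOn
    (hkF_int s 0 _ hc) (hkF_int s 0 _ (hkF_cos_pm hc))).symm

/-- Mittag-Leffler integrand in logarithmic coordinates. -/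
noncomputable def hkG (a : ℝ) (z : ℂ) (b : ℝ) (w : ℂ) : ℂ :=
  hkF b w * cexp (a * w) / (cexp (a * w) - z)

/-- Absolute integral over the contour. -/
noncomputable def hkA (s x θ : ℝ) : ℝ :=
  (∫ y in (-θ)..θ, ‖hkF s (x + y * I)‖) + (∫ t in Ioi x, ‖hkF s (t + θ * I)‖)
    + ∫ t in Ioi x, ‖hkF s (t + ((-θ : ℝ) : ℂ) * I)‖

lemma hkA_nonneg (s x θ : ℝ) (hθ : 0 ≤ θ) : 0 ≤ hkA s x θ := by
  unfold hkA
  have h1 : 0 ≤ ∫ y in (-θ)..θ, ‖hkF s (x + y * I)‖ :=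
    intervalIntegral.integral_nonneg (by linarith) (fun _ _ => norm_nonneg _)
  have h2 : 0 ≤ ∫ t in Ioi x, ‖hkF s (t + θ * I)‖ := integral_nonneg (fun _ => norm_nonneg _)
  have h3 : 0 ≤ ∫ t in Ioi x, ‖hkF s (t + ((-θ : ℝ) : ℂ) * I)‖ :=
    integral_nonneg (fun _ => norm_nonneg _)
  linarith

lemma hkJ_le (f : ℂ → ℂ) (s x θ c : ℝ) (hθ : 0 ≤ θ) (hcos : Real.cos θ < 0)
    (hf : ∀ w : ℂ, x ≤ w.re → |w.im| ≤ θ → ‖f w‖ ≤ c * ‖hkF s w‖) :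
    ‖hkJ f x θ‖ ≤ c * hkA s x θ := by
  have ray : ∀ ε : ℝ, |ε| ≤ θ → Real.cos ε < 0 →
      ‖∫ t in Ioi x, f (t + ε * I)‖ ≤ c * ∫ t in Ioi x, ‖hkF s (t + ε * I)‖ := by
    intro ε h1 h2
    rw [← integral_const_mul]
    apply norm_integral_le_of_norm_le ((hkF_int s x ε h2).norm.const_mul c)
    filter_upwards [ae_restrict_mem measurableSet_Ioi] with t ht
    exact hf _ (by simpa using (le_of_lt ht)) (by simpa using h1)
  have vert : ‖I * ∫ y in (-θ)..θ, f (x + y * I)‖ ≤ c * ∫ y in (-θ)..θ, ‖hkF s (x + y * I)‖ := by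
    rw [norm_mul, Complex.norm_I, one_mul, ← intervalIntegral.integral_const_mul]
    apply intervalIntegral.norm_integral_le_of_norm_le (by linarith)
    · filter_upwards with y hy
      exact hf _ (by simp) (by simpa using abs_le.2 ⟨hy.1.le, hy.2⟩)
    · exact (((hkF_cont_v s x).norm).const_mul c).intervalIntegrable _ _
  have r1 := ray θ (abs_of_nonneg hθ).le hcos
  have r2 := ray (-θ) (by rw [abs_neg, abs_of_nonneg hθ]) (hkF_cos_pm hcos)
  unfold hkJ hkA
  refine (norm_sub_le _ _).trans ?_
  have := norm_add_le (I * ∫ y in (-θ)..θ, f (x + y * I)) (∫ t in Ioi x, f (t + θ * I))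
  rw [mul_add, mul_add]
  linarith

lemma hkF_add (s k : ℝ) (w : ℂ) : hkF (s + k) w = hkF s w * cexp (-k * w) := by
  unfold hkF
  rw [← Complex.exp_add]; congr 1; push_cast; ring

lemma hkF_add_norm (s k : ℝ) (w : ℂ) :
    ‖hkF (s + k) w‖ = Real.exp (-(k * w.re)) * ‖hkF s w‖ := by
  rw [hkF_add, norm_mul, Complex.norm_exp, mul_comm]
  simp

lemma hk_cos_le {μ κ φ ψ : ℝ} (hμ : μ ≤ Real.pi) (hκ : κ < μ) (hφ : |φ| ≤ κ)
    (h1 : μ ≤ |ψ|) (h2 : |ψ| ≤ Real.pi) : Real.cos (φ - ψ) ≤ Real.cos (μ - κ) := by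
  rw [← Real.cos_abs (φ - ψ)]
  have d1 : μ - κ ≤ |φ - ψ| := by
    have := abs_sub_abs_le_abs_sub ψ φ
    rw [abs_sub_comm] at this
    linarith
  have d2 : |φ - ψ| ≤ Real.pi + κ := by
    have := abs_sub φ ψ
    linarith
  rcases le_or_gt |φ - ψ| Real.pi with h | h
  · exact Real.cos_le_cos_of_nonneg_of_le_pi (by linarith) h d1
  · rw [← Real.cos_two_pi_sub]
    exact Real.cos_le_cos_of_nonneg_of_le_pi (by linarith) (by linarith) (by linarith)

lemma hk_dist (a μ θ : ℝ) (z w : ℂ) (ha : 0 < a) (hμ : μ ≤ Real.pi) (hκ : a * θ < μ)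
    (hw : |w.im| ≤ θ) (h1 : μ ≤ |z.arg|) (h2 : |z.arg| ≤ Real.pi) :
    Real.sin (μ - a * θ) * ‖z‖ ≤ ‖cexp (a * w) - z‖ := by
  have hc : Real.cos (a * w.im - z.arg) ≤ Real.cos (μ - a * θ) :=
    hk_cos_le hμ hκ (by rw [abs_mul, abs_of_pos ha]; gcongr) h1 h2
  set r := Real.exp (a * w.re) with hr
  have hr0 : 0 < r := Real.exp_pos _
  have hz0 := norm_nonneg z
  have ure : (cexp (a * w)).re = r * Real.cos (a * w.im) := by simp [Complex.exp_re, hr]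
  have uim : (cexp (a * w)).im = r * Real.sin (a * w.im) := by simp [Complex.exp_im, hr]
  have zre : z.re = ‖z‖ * Real.cos z.arg := (Complex.norm_mul_cos_arg z).symm
  have zim : z.im = ‖z‖ * Real.sin z.arg := (Complex.norm_mul_sin_arg z).symm
  apply le_of_sq_le_sq _ (norm_nonneg _)
  rw [Complex.sq_norm (cexp (a * w) - z), Complex.normSq_apply, Complex.sub_re, Complex.sub_im,
    ure, uim, zre, zim]
  generalize ‖z‖ = ρ at *
  rw [Real.cos_sub] at hc
  have p1 := Real.sin_sq_add_cos_sq (μ - a * θ)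
  have p2 := Real.sin_sq_add_cos_sq (a * w.im)
  have p3 := Real.sin_sq_add_cos_sq z.arg
  generalize Real.cos (μ - a * θ) = C at *
  generalize Real.sin (μ - a * θ) = S at *
  generalize Real.cos (a * w.im) = c1 at *
  generalize Real.sin (a * w.im) = s1 at *
  generalize Real.cos z.arg = c2 at *
  generalize Real.sin z.arg = s2 at *
  have hm := mul_le_mul_of_nonneg_left hc (mul_nonneg hr0.le hz0)
  have hS : S ^ 2 = 1 - C ^ 2 := by linarith
  have e : (r * c1 - ρ * c2) * (r * c1 - ρ * c2) + (r * s1 - ρ * s2) * (r * s1 - ρ * s2)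
      = r ^ 2 + ρ ^ 2 - 2 * (r * ρ * (c1 * c2 + s1 * s2)) := by
    linear_combination r ^ 2 * p2 + ρ ^ 2 * p3
  rw [e, mul_pow, hS]
  nlinarith [sq_nonneg (r - ρ * C)]

/-- Standing hypotheses. -/
structure HkH (a μ θ : ℝ) (z : ℂ) : Prop where
  ha : 0 < a
  hμ : μ ≤ Real.pi
  hκ : a * θ < μ
  hθ1 : Real.pi / 2 < θ
  hθ2 : θ ≤ Real.pi
  h1 : μ ≤ |z.arg|
  h2 : |z.arg| ≤ Real.pi

section
variable {a μ θ : ℝ} {z : ℂ}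

lemma HkH.th0 (H : HkH a μ θ z) : 0 < θ := by linarith [H.hθ1, Real.pi_pos]

lemma HkH.mu0 (H : HkH a μ θ z) : 0 < μ := (mul_pos H.ha H.th0).trans H.hκ

lemma HkH.hz (H : HkH a μ θ z) : 0 < ‖z‖ := by
  rw [norm_pos_iff]
  rintro rfl
  have := H.h1
  simp only [Complex.arg_zero, abs_zero] at this
  linarith [H.mu0]

lemma HkH.hsin (H : HkH a μ θ z) : 0 < Real.sin (μ - a * θ) :=
  Real.sin_pos_of_pos_of_lt_pi (by linarith [H.hκ]) (by linarith [H.hμ, mul_pos H.ha H.th0])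

lemma HkH.dist (H : HkH a μ θ z) (w : ℂ) (hw : |w.im| ≤ θ) :
    Real.sin (μ - a * θ) * ‖z‖ ≤ ‖cexp (a * w) - z‖ :=
  hk_dist a μ θ z w H.ha H.hμ H.hκ hw H.h1 H.h2

lemma HkH.ne (H : HkH a μ θ z) (w : ℂ) (hw : |w.im| ≤ θ) : cexp (a * w) - z ≠ 0 := by
  rw [← norm_pos_iff]
  exact (mul_pos H.hsin H.hz).trans_le (H.dist w hw)

lemma HkH.hcos (H : HkH a μ θ z) : Real.cos θ < 0 := hk_cos_neg H.hθ1 H.hθ2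

lemma HkH.G_le (H : HkH a μ θ z) (b : ℝ) (w : ℂ) (hw : |w.im| ≤ θ) :
    ‖hkG a z b w‖ ≤ (Real.sin (μ - a * θ) * ‖z‖)⁻¹ * ‖hkF (b - a) w‖ := by
  have e : hkF (b - a) w = hkF b w * cexp (a * w) := by
    have := hkF_add b (-a) w
    rw [← sub_eq_add_neg] at this
    rw [this]; simp
  rw [hkG, ← e, norm_div, div_eq_inv_mul]
  have := H.dist w hw
  have h0 := mul_pos H.hsin H.hz
  gcongr

lemma HkH.G_diff (H : HkH a μ θ z) (b : ℝ) :
    DifferentiableOn ℂ (hkG a z b) {w | -θ ≤ w.im ∧ w.im ≤ θ} := by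
  intro w hw
  have hF := hkF_diff b w
  have hn := H.ne w (abs_le.2 hw)
  apply DifferentiableAt.differentiableWithinAt
  unfold hkG
  exact (hF.mul (by fun_prop)).div (by fun_prop) hn

lemma HkH.G_cont_h (H : HkH a μ θ z) (b ε : ℝ) (hε : |ε| ≤ θ) :
    Continuous (fun t : ℝ => hkG a z b (t + ε * I)) := by
  have := (H.G_diff b).continuousOn.comp_continuous (f := fun t : ℝ => (t : ℂ) + ε * I)
    (by fun_prop) (by intro t; simpa using abs_le.1 hε)
  exact this

lemma HkH.G_int_h (H : HkH a μ θ z) (b ε x : ℝ) (hε : |ε| ≤ θ) (hc : Real.cos ε < 0) :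
    IntegrableOn (fun t : ℝ => hkG a z b (t + ε * I)) (Ioi x) := by
  refine Integrable.mono' ((hkF_int (b - a) x ε hc).norm.const_mul
    ((Real.sin (μ - a * θ) * ‖z‖)⁻¹)) (H.G_cont_h b ε hε).aestronglyMeasurable ?_
  filter_upwards with t
  exact H.G_le b _ (by simpa using hε)

lemma HkH.G_int_v (H : HkH a μ θ z) (b x : ℝ) :
    IntervalIntegrable (fun y : ℝ => hkG a z b (x + y * I)) volume (-θ) θ := by
  apply ContinuousOn.intervalIntegrable
  rw [uIcc_of_le (by linarith [H.th0])]
  refine (H.G_diff b).continuousOn.comp (by fun_prop) ?_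
  intro y hy
  simpa using hy

lemma HkH.G_step (H : HkH a μ θ z) (b : ℝ) (w : ℂ) (hw : |w.im| ≤ θ) :
    hkG a z b w = hkF b w + z * hkG a z (b + a) w := by
  have hn := H.ne w hw
  have e : hkF (b + a) w * cexp (a * w) = hkF b w := by
    rw [hkF_add, mul_assoc, ← Complex.exp_add]; simp
  rw [hkG, hkG, e]
  field_simp
  ring

lemma HkH.J_step (H : HkH a μ θ z) (b x : ℝ) :
    hkJ (hkG a z b) x θ = hkJ (hkF b) x θ + z * hkJ (hkG a z (b + a)) x θ := by
  have ray : ∀ ε : ℝ, |ε| ≤ θ → Real.cos ε < 0 → ∫ t in Ioi x, hkG a z b (t + ε * I)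
      = (∫ t in Ioi x, hkF b (t + ε * I)) + z * ∫ t in Ioi x, hkG a z (b + a) (t + ε * I) := by
    intro ε h1 h2
    rw [← integral_const_mul, ← integral_add (hkF_int b x ε h2)
      ((H.G_int_h (b + a) ε x h1 h2).const_mul z)]
    congr 1
    ext t
    exact H.G_step b _ (by simpa using h1)
  have vert : ∫ y in (-θ)..θ, hkG a z b (x + y * I) = (∫ y in (-θ)..θ, hkF b (x + y * I))
      + z * ∫ y in (-θ)..θ, hkG a z (b + a) (x + y * I) := by
    rw [← intervalIntegral.integral_const_mul, ← intervalIntegral.integral_add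
      ((hkF_cont_v b x).intervalIntegrable _ _) ((H.G_int_v (b + a) x).const_mul z)]
    apply intervalIntegral.integral_congr
    intro y hy
    rw [uIcc_of_le (by linarith [H.th0])] at hy
    exact H.G_step b _ (by simpa using abs_le.2 hy)
  have t0 := H.th0.le
  unfold hkJ
  rw [vert, ray θ (abs_of_nonneg t0).le H.hcos,
    ray (-θ) (by rw [abs_neg, abs_of_nonneg t0]) (hkF_cos_pm H.hcos)]
  ring

lemma HkH.J_shift (H : HkH a μ θ z) (b x : ℝ) (hx : 0 ≤ x) :
    hkJ (hkG a z b) 0 θ = hkJ (hkG a z b) x θ := by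
  have t0 := H.th0.le
  exact hkJ_shift _ 0 x θ hx t0 (H.G_diff b)
    (H.G_int_h b θ 0 (abs_of_nonneg t0).le H.hcos)
    (H.G_int_h b (-θ) 0 (by rw [abs_neg, abs_of_nonneg t0]) (hkF_cos_pm H.hcos))

lemma HkH.J_sum (H : HkH a μ θ z) (b x : ℝ) (hx : 0 ≤ x) (N : ℕ) :
    hkJ (hkG a z b) x θ = 2 * Real.pi * I *
      (∑ n ∈ Finset.range N, z ^ n / Complex.Gamma ((a * n : ℝ) + b))
      + z ^ N * hkJ (hkG a z (b + N * a)) x θ := by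
  induction N with
  | zero => simp
  | succ N ih =>
    rw [ih, Finset.sum_range_succ, H.J_step (b + N * a) x, hankel _ x θ hx H.hθ1 H.hθ2]
    have e1 : ((b + N * a : ℝ) : ℂ) = (a * N : ℝ) + b := by push_cast; ring
    have e2 : b + N * a + a = b + ((N + 1 : ℕ) : ℝ) * a := by push_cast; ring
    rw [e1, e2]
    ring

end

lemma hk_gamma_le (s k x θ : ℝ) (hk : 0 ≤ k) (hx : 0 ≤ x) (h1 : Real.pi / 2 < θ)
    (h2 : θ ≤ Real.pi) :
    ‖(Complex.Gamma ((s + k : ℝ) : ℂ))⁻¹‖ ≤ Real.exp (-(k * x)) * hkA s x θ := by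
  have hp := Real.pi_pos
  have h := hankel (s + k) x θ hx h1 h2
  have hle := hkJ_le (hkF (s + k)) s x θ (Real.exp (-(k * x))) (by linarith) (hk_cos_neg h1 h2) (by
    intro w hw _
    rw [hkF_add_norm]
    gcongr)
  rw [h, div_eq_mul_inv, norm_mul] at hle
  have e : ‖(2 * Real.pi * I : ℂ)‖ = 2 * Real.pi := by
    simp [abs_of_pos hp]
  rw [e] at hle
  refine le_trans ?_ hle
  have := norm_nonneg (Complex.Gamma ((s + k : ℝ) : ℂ))⁻¹
  nlinarith [Real.pi_gt_three]

lemma hk_exists_x (a r : ℝ) (ha : 0 < a) : ∃ x ≥ 0, r * Real.exp (-(a * x)) ≤ 1 / 2 := by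
  have h : Tendsto (fun x : ℝ => r * Real.exp (-(a * x))) atTop (𝓝 (r * 0)) :=
    (Real.tendsto_exp_neg_atTop_nhds_zero.comp (tendsto_id.const_mul_atTop ha)).const_mul r
  rw [mul_zero] at h
  obtain ⟨x, hx⟩ := ((h.eventually (ge_mem_nhds (by norm_num : (0 : ℝ) < 1 / 2))).and
    (eventually_ge_atTop 0)).exists
  exact ⟨x, hx.2, hx.1⟩

lemma hk_term (a b : ℝ) (ha : 0 < a) (r : ℝ) (hr : 0 ≤ r) :
    Summable (fun n : ℕ => r ^ n * ‖(Complex.Gamma ((a * n : ℝ) + (b : ℂ)))⁻¹‖) := by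
  have hp := Real.pi_pos
  obtain ⟨x, hx, hq⟩ := hk_exists_x a r ha
  have hA := hkA_nonneg b x Real.pi hp.le
  refine Summable.of_nonneg_of_le (fun n => by positivity) (f := fun n => (1 / 2 : ℝ) ^ n *
    hkA b x Real.pi) (fun n => ?_) (summable_geometric_two.mul_right _)
  have h := hk_gamma_le b (a * n) x Real.pi (by positivity) hx (by linarith) le_rfl
  have e : ((b + a * n : ℝ) : ℂ) = (a * n : ℝ) + (b : ℂ) := by push_cast; ring
  rw [e] at h
  calc _ ≤ r ^ n * (Real.exp (-(a * n * x)) * hkA b x Real.pi) := by gcongr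
    _ = (r * Real.exp (-(a * x))) ^ n * hkA b x Real.pi := by
      rw [mul_pow, ← Real.exp_nat_mul]; ring_nf
    _ ≤ _ := by gcongr

lemma ml_repr {a μ θ : ℝ} {z : ℂ} (H : HkH a μ θ z) (b : ℝ) :
    2 * Real.pi * I * mlC a b z = hkJ (hkG a z b) 0 θ := by
  obtain ⟨x, hx, hq⟩ := hk_exists_x a ‖z‖ H.ha
  have hs : Summable (fun n : ℕ => z ^ n / Complex.Gamma ((a * n : ℝ) + (b : ℂ))) := by
    refine Summable.of_norm ((hk_term a b H.ha ‖z‖ H.hz.le).congr ?_)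
    intro n
    rw [div_eq_mul_inv, norm_mul, norm_pow]
  have t1 := (hs.hasSum.tendsto_sum_nat).const_mul (2 * Real.pi * I)
  set D := (Real.sin (μ - a * θ) * ‖z‖)⁻¹ * hkA (b - a) x θ with hD
  have hA := hkA_nonneg (b - a) x θ H.th0.le
  have h0 := mul_pos H.hsin H.hz
  have t2 : Tendsto (fun N : ℕ => z ^ N * hkJ (hkG a z (b + N * a)) x θ) atTop (𝓝 0) := by
    have g : Tendsto (fun N : ℕ => (1 / 2 : ℝ) ^ N * D) atTop (𝓝 0) := by
      simpa using (tendsto_pow_atTop_nhds_zero_of_lt_one (by norm_num : (0 : ℝ) ≤ 1 / 2)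
        (by norm_num)).mul_const D
    refine squeeze_zero_norm (fun N => ?_) g
    have hle := hkJ_le (hkG a z (b + N * a)) (b - a) x θ
      ((Real.sin (μ - a * θ) * ‖z‖)⁻¹ * Real.exp (-(N * a * x))) H.th0.le H.hcos (by
        intro w hw1 hw2
        refine (H.G_le (b + N * a) w hw2).trans ?_
        have e : b + N * a - a = (b - a) + N * a := by ring
        have hNa : 0 ≤ (N : ℝ) * a := mul_nonneg (Nat.cast_nonneg N) H.ha.le
        rw [e, hkF_add_norm, mul_assoc _ (Real.exp _) ‖hkF (b - a) w‖]
        gcongr)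
    rw [norm_mul, norm_pow]
    calc _ ≤ ‖z‖ ^ N * ((Real.sin (μ - a * θ) * ‖z‖)⁻¹ * Real.exp (-(N * a * x)) *
          hkA (b - a) x θ) := by gcongr
      _ = (‖z‖ * Real.exp (-(a * x))) ^ N * D := by
        rw [mul_pow, ← Real.exp_nat_mul, hD]; ring_nf
      _ ≤ _ := by gcongr
  have t3 := t1.add t2
  simp only [← H.J_sum b x hx] at t3
  rw [H.J_shift b x hx, mlC]
  simpa using tendsto_nhds_unique t3 tendsto_const_nhds

theorem mittagLeffler_decay_sector (a b μ : ℝ) (ha0 : 0 < a) (ha2 : a < 2)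
    (hμ1 : a * Real.pi / 2 < μ) (hμ2 : μ < min Real.pi (a * Real.pi)) :
    ∃ C > 0, ∀ z : ℂ, μ ≤ |z.arg| → |z.arg| ≤ Real.pi →
      ‖mlC a (b : ℂ) z‖ ≤ C / (1 + ‖z‖) := by
  have hp := Real.pi_pos
  obtain ⟨hm1, hm2⟩ := lt_min_iff.1 hμ2
  obtain ⟨θ, hθ1, hθ2⟩ : ∃ θ, Real.pi / 2 < θ ∧ θ < μ / a :=
    exists_between (by rw [lt_div_iff₀ ha0]; linarith)
  have hκ : a * θ < μ := by rw [lt_div_iff₀ ha0] at hθ2; linarith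
  have hθ3 : θ ≤ Real.pi := by
    refine hθ2.le.trans ?_
    rw [div_le_iff₀ ha0]; linarith
  have hsum := hk_term a b ha0 1 zero_le_one
  simp only [one_pow, one_mul] at hsum
  set M := ∑' n : ℕ, ‖(Complex.Gamma ((a * n : ℝ) + (b : ℂ)))⁻¹‖ with hM
  have hM0 : 0 ≤ M := tsum_nonneg (fun _ => norm_nonneg _)
  set A := hkA (b - a) 0 θ with hA
  have hA0 : 0 ≤ A := hkA_nonneg _ _ _ (by linarith)
  have hS : 0 < Real.sin (μ - a * θ) :=
    Real.sin_pos_of_pos_of_lt_pi (by linarith) (by nlinarith)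
  set S := Real.sin (μ - a * θ)
  refine ⟨2 * M + 2 * (S⁻¹ * A) + 1, by positivity, fun z h1 h2 => ?_⟩
  have H : HkH a μ θ z := ⟨ha0, hm1.le, hκ, hθ1, hθ3, h1, h2⟩
  have hz := H.hz
  rw [le_div_iff₀ (by linarith)]
  have hSA : 0 ≤ S⁻¹ * A := by positivity
  rcases le_or_gt ‖z‖ 1 with hz1 | hz1
  · have hb : ‖mlC a (b : ℂ) z‖ ≤ M := by
      unfold mlC
      refine tsum_of_norm_bounded hsum.hasSum (fun n => ?_)
      rw [div_eq_mul_inv, norm_mul, norm_pow]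
      exact mul_le_of_le_one_left (norm_nonneg _) (pow_le_one₀ hz.le hz1)
    nlinarith [norm_nonneg (mlC a (b : ℂ) z)]
  · have hle := hkJ_le (hkG a z b) (b - a) 0 θ (S * ‖z‖)⁻¹ H.th0.le H.hcos
      (fun w _ hw => H.G_le b w hw)
    rw [← ml_repr H b, norm_mul] at hle
    have e : ‖(2 * Real.pi * I : ℂ)‖ = 2 * Real.pi := by
      simp [abs_of_pos hp]
    rw [e] at hle
    have hn := norm_nonneg (mlC a (b : ℂ) z)
    have h3 : ‖mlC a (b : ℂ) z‖ ≤ (S * ‖z‖)⁻¹ * A := by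
      refine le_trans ?_ hle
      nlinarith [Real.pi_gt_three]
    have h4 : ‖mlC a (b : ℂ) z‖ * ‖z‖ ≤ S⁻¹ * A := by
      calc _ ≤ (S * ‖z‖)⁻¹ * A * ‖z‖ := by gcongr
        _ = S⁻¹ * A := by field_simp
    nlinarith
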